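/- arXiv:2304.04557 — 12 statements merged into one kernel-verified Lean document; each statement's English description precedes it below -/
import Mathlib

section
/- Let G be a finite group, and let W₁, …, W_s be pairwise non-isomorphic irreducible finite-dimensional complex representations of G with characters χ₁, …, χ_s. Suppose σ is a map of the index set {1, …, s} to itself such that W_{σ(i)} is isomorphic to the dual representation of W_i for every i. Let μ : {1, …, s} → ℕ, and for each i set ι_i := (1/|G|) · Σ_{g ∈ G} χ_i(g²). Then Σ_{i=1}^s μ_i · ( μ_{σ(i)} + ι_i ) = 0 if and only if all of the following hold for every index i: (a) if ι_i = 1 then μ_i = 0; (b) if ι_i = 0 then μ_i = 0 or μ_{σ(i)} = 0; (c) if ι_i = −1 then μ_i ≤ 1. -/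
open scoped BigOperators

/-- The trace of the swap composed with `A ⊗ B` is the trace of `A * B`. -/
theorem LinearMap.trace_comm_comp_map {k V : Type*} [Field k] [AddCommGroup V] [Module k V]
    [FiniteDimensional k V] (A B : V →ₗ[k] V) :
    LinearMap.trace k (TensorProduct k V V)
        ((TensorProduct.comm k V V).toLinearMap ∘ₗ TensorProduct.map A B) =
      LinearMap.trace k V (A * B) := by
  classical
  let b := Module.finBasis k V
  rw [LinearMap.trace_eq_matrix_trace k (b.tensorProduct b), LinearMap.trace_eq_matrix_trace k b,
    LinearMap.toMatrix_mul]
  simp only [Matrix.trace, Matrix.diag_apply, Matrix.mul_apply, Fintype.sum_prod_type,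
    LinearMap.toMatrix_apply, Module.Basis.tensorProduct_apply, LinearMap.comp_apply,
    TensorProduct.map_tmul, LinearEquiv.coe_coe, TensorProduct.comm_tmul,
    Module.Basis.tensorProduct_repr_tmul_apply, smul_eq_mul]
  rw [Finset.sum_comm]

namespace Representation

variable {k G V : Type*} [Field k] [Group G] [AddCommGroup V] [Module k V]
  (ρ : Representation k G V)

theorem comm_mem_invariants_tprod {x : TensorProduct k V V}
    (hx : x ∈ (ρ.tprod ρ).invariants) :
    _root_.TensorProduct.comm k V V x ∈ (ρ.tprod ρ).invariants := by
  intro g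
  have h : TensorProduct.map (ρ g) (ρ g) (_root_.TensorProduct.comm k V V x) =
      _root_.TensorProduct.comm k V V (TensorProduct.map (ρ g) (ρ g) x) :=
    TensorProduct.map_comm _ _ _
  rw [tprod_apply, h, ← tprod_apply, hx g]

variable [Fintype G] [FiniteDimensional k V]

/-- The Frobenius–Schur indicator is the trace of the swap on the invariants of `V ⊗ V`. -/
theorem trace_comm_comp_average [Invertible (Fintype.card G : k)] :
    LinearMap.trace k (TensorProduct k V V)
        ((_root_.TensorProduct.comm k V V).toLinearMap ∘ₗ (ρ.tprod ρ).averageMap) =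
      (Nat.card G : k)⁻¹ * ∑ g : G, ρ.character (g ^ 2) := by
  have h : (ρ.tprod ρ).averageMap =
      (Nat.card G : k)⁻¹ • ∑ g : G, TensorProduct.map (ρ g) (ρ g) := by
    simp [averageMap, GroupAlgebra.average, map_sum]
  rw [h, LinearMap.comp_smul, map_smul, smul_eq_mul]
  have hsum : (_root_.TensorProduct.comm k V V).toLinearMap ∘ₗ
      (∑ g : G, TensorProduct.map (ρ g) (ρ g)) =
        ∑ g : G, (_root_.TensorProduct.comm k V V).toLinearMap ∘ₗ TensorProduct.map (ρ g) (ρ g) :=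
    map_sum (LinearMap.compRight k (_root_.TensorProduct.comm k V V).toLinearMap) _ _
  rw [hsum, map_sum]
  simp_rw [LinearMap.trace_comm_comp_map, ← map_mul, ← pow_two]
  rfl

variable [Invertible (Nat.card G : k)] [CharZero k]

/-- The Frobenius–Schur indicator vanishes if `V ⊗ V` has no nonzero invariants. -/
theorem frobeniusSchur_eq_zero
    (h : (Nat.card G : k)⁻¹ * ∑ g : G, ρ.character g * ρ.character g = 0) :
    (Nat.card G : k)⁻¹ * ∑ g : G, ρ.character (g ^ 2) = 0 := by
  have : Invertible (Fintype.card G : k) := by rwa [Fintype.card_eq_nat_card]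
  have hr := card_inv_mul_sum_char_eq_finrank (ρ.tprod ρ)
  simp only [char_tensor, Pi.mul_apply, h] at hr
  have h0 : (ρ.tprod ρ).invariants = ⊥ := by
    rw [← Submodule.finrank_eq_zero (R := k)]
    exact_mod_cast hr.symm
  have hP : (ρ.tprod ρ).averageMap = 0 := by
    ext1
    ext x y
    simpa [h0] using (ρ.tprod ρ).averageMap_invariant (x ⊗ₜ y)
  rw [← trace_comm_comp_average, hP]
  simp

/-- The Frobenius–Schur indicator is `±1` if the invariants of `V ⊗ V` form a line. -/
theorem frobeniusSchur_eq_one_or_neg_one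
    (h : (Nat.card G : k)⁻¹ * ∑ g : G, ρ.character g * ρ.character g = 1) :
    (Nat.card G : k)⁻¹ * ∑ g : G, ρ.character (g ^ 2) = 1 ∨
      (Nat.card G : k)⁻¹ * ∑ g : G, ρ.character (g ^ 2) = -1 := by
  have : Invertible (Fintype.card G : k) := by rwa [Fintype.card_eq_nat_card]
  have hr := card_inv_mul_sum_char_eq_finrank (ρ.tprod ρ)
  simp only [char_tensor, Pi.mul_apply, h] at hr
  have h1 : Module.finrank k (ρ.tprod ρ).invariants = 1 := by exact_mod_cast hr.symm
  obtain ⟨⟨v, hv⟩, hv0, hspan⟩ := finrank_eq_one_iff'.mp h1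
  have hv0 : v ≠ 0 := fun h => hv0 (Subtype.ext h)
  obtain ⟨c, hc⟩ := hspan ⟨_, ρ.comm_mem_invariants_tprod hv⟩
  replace hc : c • v = _root_.TensorProduct.comm k V V v := congrArg Subtype.val hc
  have hcc : c * c = 1 := by
    have h2 : (c * c) • v = (1 : k) • v := by
      rw [mul_smul, hc, ← map_smul, hc, one_smul]
      exact (_root_.TensorProduct.comm k V V).symm_apply_apply v
    exact smul_left_injective k hv0 h2
  have hP : (_root_.TensorProduct.comm k V V).toLinearMap ∘ₗ (ρ.tprod ρ).averageMap =
      c • (ρ.tprod ρ).averageMap := by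
    refine LinearMap.ext fun x => ?_
    obtain ⟨a, ha⟩ := hspan ⟨_, (ρ.tprod ρ).averageMap_invariant x⟩
    replace ha : a • v = (ρ.tprod ρ).averageMap x := congrArg Subtype.val ha
    rw [LinearMap.comp_apply, LinearMap.smul_apply, ← ha, map_smul, smul_comm, hc]
    rfl
  rw [← trace_comm_comp_average, hP, map_smul, (isProj_averageMap _).trace, h1]
  simpa using mul_self_eq_one_iff.mp hcc

end Representation

/-- For irreducible `V` and `V'` with `V'` isomorphic to the dual of `V`, the Frobenius–Schur
indicator of `V` is `±1` if `V ≅ V'` and `0` otherwise. -/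
theorem FDRep.frobeniusSchur_cases {G : Type} [Group G] [Fintype G] (V V' : FDRep ℂ G)
    [CategoryTheory.Simple V] [CategoryTheory.Simple V']
    (e : V' ≅ FDRep.of (Representation.dual V.ρ)) :
    (Nonempty (V ≅ V') → (1 / (Fintype.card G : ℂ)) * ∑ g : G, V.character (g ^ 2) = 1 ∨
      (1 / (Fintype.card G : ℂ)) * ∑ g : G, V.character (g ^ 2) = -1) ∧
    (¬ Nonempty (V ≅ V') → (1 / (Fintype.card G : ℂ)) * ∑ g : G, V.character (g ^ 2) = 0) := by
  have : Invertible (Nat.card G : ℂ) :=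
    invertibleOfNonzero (Nat.cast_ne_zero.mpr Nat.card_pos.ne')
  have ho := FDRep.char_orthonormal V V'
  simp only [FDRep.char_iso e, FDRep.char_dual, inv_inv] at ho
  rw [one_div, Fintype.card_eq_nat_card]
  refine ⟨fun h => ?_, fun h => ?_⟩
  · rw [if_pos h] at ho
    exact Representation.frobeniusSchur_eq_one_or_neg_one V.ρ ho
  · rw [if_neg h] at ho
    exact Representation.frobeniusSchur_eq_zero V.ρ ho

/-- Corollary 3.4 / Proposition 1.1 of the paper: the vanishing criterion for `N`. -/
theorem stmt1 {G : Type} [Group G] [Fintype G] {s : ℕ}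
    (W : Fin s → FDRep ℂ G)
    (hirr : ∀ i, CategoryTheory.Simple (W i))
    (hdistinct : ∀ i j, i ≠ j → IsEmpty (W i ≅ W j))
    (σ : Fin s → Fin s)
    (hdual : ∀ i, Nonempty (W (σ i) ≅ FDRep.of (Representation.dual (W i).ρ)))
    (μ : Fin s → ℕ)
    (ι : Fin s → ℂ)
    (hι : ∀ i, ι i = (1 / (Fintype.card G : ℂ)) * ∑ g : G, (W i).character (g ^ 2)) :
    (∑ i, (μ i : ℂ) * ((μ (σ i) : ℂ) + ι i)) = 0 ↔
      ∀ i, (ι i = 1 → μ i = 0) ∧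
        (ι i = 0 → μ i = 0 ∨ μ (σ i) = 0) ∧
        (ι i = -1 → μ i ≤ 1) := by
  have key : ∀ i, (σ i = i ∧ (ι i = 1 ∨ ι i = -1)) ∨ ι i = 0 := by
    intro i
    obtain ⟨h1, h2⟩ := FDRep.frobeniusSchur_cases (W i) (W (σ i)) (hdual i).some
    rw [← hι i] at h1 h2
    by_cases h : σ i = i
    · exact Or.inl ⟨h, h1 ⟨CategoryTheory.eqToIso (by rw [h])⟩⟩
    · exact Or.inr (h2 (not_nonempty_iff.mpr (hdistinct _ _ (Ne.symm h))))
  have term : ∀ i, ∃ n : ℕ, (μ i : ℂ) * ((μ (σ i) : ℂ) + ι i) = n ∧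
      (n = 0 ↔ (ι i = 1 → μ i = 0) ∧ (ι i = 0 → μ i = 0 ∨ μ (σ i) = 0) ∧
        (ι i = -1 → μ i ≤ 1)) := by
    intro i
    have hneg : (1 : ℂ) ≠ -1 := by norm_num
    rcases key i with ⟨hσ, h | h⟩ | h
    · refine ⟨μ i * (μ i + 1), by simp [h, hσ], ?_⟩
      simp [h, hneg]
    · refine ⟨μ i * (μ i - 1), ?_, ?_⟩
      · rcases Nat.eq_zero_or_pos (μ i) with h0 | h0
        · simp [h0]
        · rw [hσ, h, Nat.cast_mul, Nat.cast_sub h0]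
          push_cast
          ring
      · simp only [h, hneg.symm, mul_eq_zero, false_implies, true_and, neg_eq_zero, one_ne_zero,
          true_implies]
        omega
    · refine ⟨μ i * μ (σ i), by simp [h], ?_⟩
      simp [h]
  choose n hn hn0 using term
  simp_rw [hn, ← hn0]
  rw [← Nat.cast_sum, Nat.cast_eq_zero, Finset.sum_eq_zero_iff]
  simp
end

section
/- For every integer l with 1 ≤ l ≤ q − 1, the sum S_l = l + [k·l] + ⋯ + [k^{n−1}·l] is divisible by q. -/
open scoped BigOperators

/-- Lemma 4.3 (preamble): `S_l = l + [k·l] + ⋯ + [k^{n−1}·l]` is a multiple of `q`. -/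
theorem stmt2 (q n k : ℕ) (hq : Nat.Prime q) (hn : 1 < n) (hk1 : 1 < k) (hkq : k < q)
    (hord : orderOf (k : ZMod q) = n)
    (l : ℕ) (hl1 : 1 ≤ l) (hl2 : l ≤ q - 1) :
    q ∣ ∑ j ∈ Finset.range n, k ^ j * l % q := by
  have : Fact q.Prime := ⟨hq⟩
  have hk_ne : (k : ZMod q) - 1 ≠ 0 := by
    rw [sub_ne_zero]
    intro h
    rw [h, orderOf_one] at hord
    omega
  have hpow : (k : ZMod q) ^ n = 1 := hord ▸ pow_orderOf_eq_one (k : ZMod q)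
  have hgeom : ∑ j ∈ Finset.range n, (k : ZMod q) ^ j = 0 := by
    have h := geom_sum_mul (k : ZMod q) n
    rw [hpow, sub_self] at h
    exact (mul_eq_zero.mp h).resolve_right hk_ne
  rw [← ZMod.natCast_eq_zero_iff]
  push_cast [ZMod.natCast_mod]
  rw [← Finset.sum_mul, hgeom, zero_mul]
end

section
/- If n is even, then for every integer l with 1 ≤ l ≤ q − 1 one has S_l = (n/2)·q. -/
theorem Nat.mod_add_mod_eq_of_dvd_add {q a b : ℕ} (hq : 0 < q) (hab : q ∣ a + b) (ha : ¬ q ∣ a) :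
    a % q + b % q = q := by
  have ha' : 0 < a % q := Nat.pos_of_ne_zero fun h => ha (Nat.dvd_of_mod_eq_zero h)
  have hsum : q ∣ a % q + b % q := by
    rwa [Nat.dvd_iff_mod_eq_zero, ← Nat.add_mod, ← Nat.dvd_iff_mod_eq_zero]
  have h₁ := Nat.mod_lt a hq
  have h₂ := Nat.mod_lt b hq
  obtain ⟨c, hc⟩ := hsum
  have hc₁ : c = 1 := by
    have : c < 2 := by by_contra! h; nlinarith
    have : c ≠ 0 := by rintro rfl; omega
    omega
  rw [hc, hc₁, mul_one]

theorem pow_eq_neg_one_of_orderOf_eq_add_self {R : Type*} [Ring R] [NoZeroDivisors R] {x : R}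
    {m : ℕ} (hm : 0 < m) (hx : orderOf x = m + m) : x ^ m = -1 := by
  have hsq : x ^ m * x ^ m = 1 := by rw [← pow_add, ← hx, pow_orderOf_eq_one]
  exact (mul_self_eq_one_iff.mp hsq).resolve_left
    (pow_ne_one_of_lt_orderOf hm.ne' (by omega))

/-- Lemma 4.3 (i): if `n` is even then `S_l = (n/2)·q` for all `1 ≤ l ≤ q − 1`. -/
theorem stmt4 (q n k : ℕ) (hq : Nat.Prime q) (hn : 1 < n) (hk1 : 1 < k) (hkq : k < q)
    (hord : orderOf (k : ZMod q) = n) (heven : Even n)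
    (l : ℕ) (hl1 : 1 ≤ l) (hl2 : l ≤ q - 1) :
    (∑ j ∈ Finset.range n, k ^ j * l % q) = (n / 2) * q := by
  obtain ⟨m, rfl⟩ := heven
  have : Fact q.Prime := ⟨hq⟩
  have hneg := pow_eq_neg_one_of_orderOf_eq_add_self (by omega) hord
  have hpair (j : ℕ) : k ^ j * l % q + k ^ (m + j) * l % q = q := by
    refine Nat.mod_add_mod_eq_of_dvd_add hq.pos ?_ ?_
    · rw [← ZMod.natCast_eq_zero_iff]
      push_cast
      rw [pow_add, hneg]
      ring
    · rw [hq.dvd_mul]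
      rintro (h | h)
      · exact Nat.not_dvd_of_pos_of_lt (by omega) hkq (hq.dvd_of_dvd_pow h)
      · exact Nat.not_dvd_of_pos_of_lt hl1 (by omega) h
  rw [Finset.sum_range_add, ← Finset.sum_add_distrib, Finset.sum_congr rfl fun j _ => hpair j,
    Finset.sum_const, Finset.card_range, smul_eq_mul]
  congr 1
  omega
end

section
/- If n = 3, then for every integer l with 1 ≤ l ≤ q − 1 one has S_l = q or S_l = 2q, and moreover the number of integers l with 1 ≤ l ≤ q − 1 and S_l = q is exactly (q − 1)/2. -/
open scoped BigOperators

theorem Nat.mod_add_mod_eq_of_dvd_add_s5 {q x y : ℕ} (hx : ¬ q ∣ x) (h : q ∣ x + y) :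
    x % q + y % q = q := by
  have hq : 0 < q := Nat.pos_of_ne_zero fun h0 => by
    subst h0
    exact hx (by rw [Nat.zero_dvd] at h ⊢; omega)
  have hpos : 0 < x % q := Nat.pos_of_ne_zero fun h0 => hx (Nat.dvd_of_mod_eq_zero h0)
  have hdvd : q ∣ x % q + y % q := by
    rw [Nat.dvd_iff_mod_eq_zero, ← Nat.add_mod]
    exact Nat.mod_eq_zero_of_dvd h
  have hxlt := Nat.mod_lt x hq
  have hylt := Nat.mod_lt y hq
  obtain ⟨m, hm⟩ := hdvd
  have hm0 : 0 < m := Nat.pos_of_mul_pos_left (a := q) (by omega)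
  have hm2 : m < 2 := Nat.lt_of_mul_lt_mul_left (a := q) (by omega)
  obtain rfl : m = 1 := by omega
  omega

theorem sum_range_three_pow_mul_mod_eq {q k l : ℕ} (hl : ¬ q ∣ l) (hq : 0 < q)
    (h : q ∣ 1 + k + k ^ 2) :
    (∑ j ∈ Finset.range 3, k ^ j * l % q) = q ∨
      (∑ j ∈ Finset.range 3, k ^ j * l % q) = 2 * q := by
  have hdvd : q ∣ ∑ j ∈ Finset.range 3, k ^ j * l % q := by
    rw [Nat.dvd_iff_mod_eq_zero, ← Finset.sum_nat_mod, ← Nat.dvd_iff_mod_eq_zero,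
      ← Finset.sum_mul]
    simpa [Finset.sum_range_succ] using h.mul_right l
  have hpos : 0 < k ^ 0 * l % q :=
    Nat.pos_of_ne_zero fun h0 => hl (by simpa using Nat.dvd_of_mod_eq_zero h0)
  have h0 := Nat.mod_lt (k ^ 0 * l) hq
  have h1 := Nat.mod_lt (k ^ 1 * l) hq
  have h2 := Nat.mod_lt (k ^ 2 * l) hq
  simp only [Finset.sum_range_succ, Finset.sum_range_zero, zero_add] at hdvd ⊢
  obtain ⟨m, hm⟩ := hdvd
  have hm0 : 0 < m := Nat.pos_of_mul_pos_left (a := q) (by omega)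
  have hm3 : m < 3 := Nat.lt_of_mul_lt_mul_left (a := q) (by omega)
  obtain rfl | rfl : m = 1 ∨ m = 2 := by omega
  all_goals omega

theorem sum_pow_mul_mod_add_sum_pow_mul_sub_mod {q k l : ℕ} (n : ℕ) (hq : q.Prime)
    (hk : ¬ q ∣ k) (hl : ¬ q ∣ l) (hlq : l ≤ q) :
    (∑ j ∈ Finset.range n, k ^ j * l % q) + (∑ j ∈ Finset.range n, k ^ j * (q - l) % q) =
      n * q := by
  rw [← Finset.sum_add_distrib, Finset.sum_congr rfl (g := fun _ => q), Finset.sum_const,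
    Finset.card_range, smul_eq_mul]
  intro j _
  apply Nat.mod_add_mod_eq_of_dvd_add_s5
  · intro h
    exact (hq.dvd_mul.mp h).elim (fun h => hk (hq.dvd_of_dvd_pow h)) hl
  · rw [← mul_add, Nat.add_sub_cancel' hlq]
    exact dvd_mul_left _ _

theorem ZMod.one_add_add_sq_eq_zero {q : ℕ} [Fact q.Prime] {x : ZMod q}
    (hx : orderOf x = 3) : 1 + x + x ^ 2 = 0 := by
  have hx3 : x ^ 3 = 1 := hx ▸ pow_orderOf_eq_one x
  have hx1 : x - 1 ≠ 0 := fun h => by simp [sub_eq_zero.mp h] at hx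
  exact (mul_eq_zero.mp (by linear_combination hx3 : (x - 1) * (1 + x + x ^ 2) = 0)).resolve_left
    hx1

/-- Lemma 4.3 (ii): if `n = 3` then each `S_l` is `q` or `2q`, and `S_l = q` for exactly
`(q − 1)/2` values of `l` with `1 ≤ l ≤ q − 1`. -/
theorem stmt5 (q k : ℕ) (hq : Nat.Prime q) (hk1 : 1 < k) (hkq : k < q)
    (hord : orderOf (k : ZMod q) = 3) :
    (∀ l, 1 ≤ l → l ≤ q - 1 →
        (∑ j ∈ Finset.range 3, k ^ j * l % q) = q ∨
        (∑ j ∈ Finset.range 3, k ^ j * l % q) = 2 * q) ∧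
      ((Finset.Icc 1 (q - 1)).filter
          (fun l => (∑ j ∈ Finset.range 3, k ^ j * l % q) = q)).card = (q - 1) / 2 := by
  have : Fact q.Prime := ⟨hq⟩
  have hdvd : q ∣ 1 + k + k ^ 2 := by
    rw [← ZMod.natCast_eq_zero_iff]
    exact_mod_cast ZMod.one_add_add_sq_eq_zero hord
  have hk : ¬ q ∣ k := Nat.not_dvd_of_pos_of_lt (by omega) hkq
  have hndvd : ∀ l, 1 ≤ l → l ≤ q - 1 → ¬ q ∣ l := fun l h1 h2 =>
    Nat.not_dvd_of_pos_of_lt h1 (by omega)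
  have hS : ∀ l, 1 ≤ l → l ≤ q - 1 →
      (∑ j ∈ Finset.range 3, k ^ j * l % q) = q ∨
      (∑ j ∈ Finset.range 3, k ^ j * l % q) = 2 * q := fun l h1 h2 =>
    sum_range_three_pow_mul_mod_eq (hndvd l h1 h2) hq.pos hdvd
  refine ⟨hS, ?_⟩
  have hrefl : ∀ l, 1 ≤ l → l ≤ q - 1 →
      (∑ j ∈ Finset.range 3, k ^ j * l % q) + (∑ j ∈ Finset.range 3, k ^ j * (q - l) % q) =
        3 * q := fun l h1 h2 =>
    sum_pow_mul_mod_add_sum_pow_mul_sub_mod 3 hq hk (hndvd l h1 h2) (by omega)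
  have hcard := Finset.card_filter_add_card_filter_not (s := Finset.Icc 1 (q - 1))
    (fun l => (∑ j ∈ Finset.range 3, k ^ j * l % q) = q)
  have hswap : ((Finset.Icc 1 (q - 1)).filter
        (fun l => (∑ j ∈ Finset.range 3, k ^ j * l % q) = q)).card =
      ((Finset.Icc 1 (q - 1)).filter
        (fun l => ¬ (∑ j ∈ Finset.range 3, k ^ j * l % q) = q)).card := by
    refine Finset.card_nbij' (fun l => q - l) (fun l => q - l) ?_ ?_ ?_ ?_
    all_goals
      intro l hl
      simp only [Finset.coe_filter, Finset.mem_Icc, Set.mem_ofPred_eq] at hl ⊢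
      have := hrefl l hl.1.1 hl.1.2
      have := hS l hl.1.1 hl.1.2
      omega
  rw [Nat.card_Icc] at hcard
  omega
end

section
/- If n is odd and n > 3, then there exists an integer l with 1 ≤ l ≤ q − 1 such that S_l > q and S_{q−l} > q. -/
open scoped BigOperators

/-- The sum of the least residues modulo `q` of `k ^ j * x` for `j < n`. -/
def residueSum (q n k x : ℕ) : ℕ := ∑ j ∈ Finset.range n, k ^ j * x % q

lemma residueSum_mod (q n k x : ℕ) : residueSum q n k (x % q) = residueSum q n k x :=
  Finset.sum_congr rfl fun _ _ => by simp [Nat.mul_mod]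

lemma residueSum_eq_zero_of_dvd {q x : ℕ} (n k : ℕ) (h : q ∣ x) : residueSum q n k x = 0 :=
  Finset.sum_eq_zero fun _ _ => Nat.mod_eq_zero_of_dvd (h.mul_left _)

lemma residueSum_add_le (q n k x y : ℕ) :
    residueSum q n k (x + y) ≤ residueSum q n k x + residueSum q n k y := by
  unfold residueSum
  rw [← Finset.sum_add_distrib]
  refine Finset.sum_le_sum fun j _ => ?_
  rw [mul_add, Nat.add_mod]
  exact Nat.mod_le _ _

lemma residueSum_add_residueSum {q k x y : ℕ} (n : ℕ) (hq : q.Prime) (hk : ¬ q ∣ k)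
    (hx : ¬ q ∣ x) (hxy : q ∣ x + y) :
    residueSum q n k x + residueSum q n k y = n * q := by
  unfold residueSum
  rw [← Finset.sum_add_distrib, Finset.sum_congr rfl (g := fun _ => q), Finset.sum_const,
    Finset.card_range, smul_eq_mul]
  intro j _
  have hpos : 0 < k ^ j * x % q := Nat.pos_of_ne_zero fun h =>
    (hq.dvd_mul.1 (Nat.dvd_of_mod_eq_zero h)).elim (fun h => hk (hq.dvd_of_dvd_pow h)) hx
  have hdvd : q ∣ k ^ j * x % q + k ^ j * y % q := by
    rw [Nat.dvd_iff_mod_eq_zero, ← Nat.add_mod, ← mul_add]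
    exact Nat.mod_eq_zero_of_dvd (hxy.mul_left _)
  have h₁ := Nat.mod_lt (k ^ j * x) hq.pos
  have h₂ := Nat.mod_lt (k ^ j * y) hq.pos
  obtain ⟨c, hc⟩ := hdvd
  have hc₂ : c < 2 := lt_of_mul_lt_mul_left (by lia : q * c < q * 2) q.zero_le
  interval_cases c <;> lia

/-- Lemma 4.3 (iii): if `n` is odd and `n > 3`, there is `l` with `S_l > q` and `S_{q−l} > q`. -/
theorem stmt6 (q n k : ℕ) (hq : Nat.Prime q) (hn : 3 < n) (hodd : Odd n)
    (hk1 : 1 < k) (hkq : k < q)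
    (hord : orderOf (k : ZMod q) = n) :
    ∃ l, 1 ≤ l ∧ l ≤ q - 1 ∧
      q < (∑ j ∈ Finset.range n, k ^ j * l % q) ∧
      q < (∑ j ∈ Finset.range n, k ^ j * (q - l) % q) := by
  by_contra! hne
  have hk : ¬ q ∣ k := Nat.not_dvd_of_pos_of_lt (by lia) hkq
  have hnq : 4 * q ≤ n * q := Nat.mul_le_mul_right q hn
  have hq₀ := hq.pos
  have dichotomy (x : ℕ) (hx : ¬ q ∣ x) :
      residueSum q n k x ≤ q ∨ 3 * q ≤ residueSum q n k x := by
    rw [Nat.dvd_iff_mod_eq_zero] at hx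
    have hlt := Nat.mod_lt x hq₀
    rw [← residueSum_mod]
    have hsum := residueSum_add_residueSum (x := x % q) (y := q - x % q) n hq hk
      (Nat.not_dvd_of_pos_of_lt (by lia) hlt) (by rw [Nat.add_sub_cancel' hlt.le])
    refine or_iff_not_imp_left.2 fun h => ?_
    have : residueSum q n k (q - x % q) ≤ q := hne _ (by lia) (by lia) (not_le.1 h)
    lia
  obtain ⟨b, hb, hbq⟩ : ∃ b, ¬ q ∣ b ∧ residueSum q n k b ≤ q := by
    have h1 : ¬ q ∣ 1 := hq.not_dvd_one
    by_cases h : residueSum q n k 1 ≤ q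
    · exact ⟨1, h1, h⟩
    · exact ⟨q - 1, Nat.not_dvd_of_pos_of_lt (by lia) (by lia),
        hne 1 le_rfl (by lia) (not_le.1 h)⟩
  have multiples (r : ℕ) : residueSum q n k (r * b) ≤ q := by
    induction r with
    | zero => simp [residueSum_eq_zero_of_dvd]
    | succ r ih =>
      by_cases hd : q ∣ (r + 1) * b
      · simp [residueSum_eq_zero_of_dvd n k hd]
      · have hle := residueSum_add_le q n k (r * b) b
        rw [← Nat.succ_mul] at hle
        have := dichotomy _ hd
        lia
  have hsum := residueSum_add_residueSum (y := (q - 1) * b) n hq hk hb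
    ⟨b, by rw [Nat.sub_mul, one_mul, Nat.add_sub_cancel' (Nat.le_mul_of_pos_left b hq₀)]⟩
  have := multiples (q - 1)
  lia
end

section
/- Let x, y, z be non-identity elements of the faithful metacyclic group G = (ℤ/qℤ) ⋊ (ℤ/nℤ) such that x·y·z = 1 and x, y, z generate G. Then either exactly one of x, y, z lies in the normal subgroup A (in which case it has order q and the other two elements each have order exactly n), or none of x, y, z lies in A (in which case the order of each of x, y, z divides n). -/
open SemidirectProduct

theorem SemidirectProduct.mem_range_inl_iff {N G : Type*} [Group N] [Group G] {φ : G →* MulAut N}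
    {x : N ⋊[φ] G} : x ∈ (inl : N →* N ⋊[φ] G).range ↔ x.right = 1 := by
  rw [range_inl_eq_ker_rightHom, MonoidHom.mem_ker, rightHom_eq_right]

/-- If an automorphism of a group of prime order fixes a nontrivial element, it is trivial. -/
theorem MulAut.eq_one_of_apply_eq_self {N : Type*} [Group N] {p : ℕ} [Fact p.Prime]
    (hN : Nat.card N = p) {f : MulAut N} {a : N} (ha : a ≠ 1) (hf : f a = a) : f = 1 := by
  ext b
  obtain ⟨k, rfl⟩ := Subgroup.mem_zpowers_iff.mp (mem_zpowers_of_prime_card hN ha (g' := b))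
  simp [hf]

/-- In a faithful semidirect product `N ⋊ G` with `N` of prime order, an element outside `N` is
killed by every power that kills its image in `G`. -/
theorem SemidirectProduct.pow_eq_one_of_right_ne_one {N G : Type*} [CommGroup N] [Group G]
    {φ : G →* MulAut N} (hφ : Function.Injective φ) {p : ℕ} [Fact p.Prime]
    (hN : Nat.card N = p) {x : N ⋊[φ] G} (hx : x.right ≠ 1) {m : ℕ} (hm : x.right ^ m = 1) :
    x ^ m = 1 := by
  have hr : (x ^ m).right = 1 := by
    rw [← rightHom_eq_right, map_pow, rightHom_eq_right, hm]
  ext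
  · by_contra ha
    have hfix : φ x.right (x ^ m).left = (x ^ m).left := by
      have h := congrArg SemidirectProduct.left ((Commute.refl x).pow_right m).eq
      rw [mul_left, mul_left, hr, map_one, MulAut.one_apply, mul_comm] at h
      exact mul_right_cancel h
    exact hx (hφ ((MulAut.eq_one_of_apply_eq_self hN ha hfix).trans (map_one φ).symm))
  · exact hr

/-- If `u`, `v`, `w` generate a group and a surjection `f` sends `u` and `v * w` to `1`, then `f v`
generates the image. -/
theorem orderOf_map_eq_card_of_closure_eq_top {G H : Type*} [Group G] [Group H] {f : G →* H}
    (hf : Function.Surjective f) {u v w : G} (hgen : Subgroup.closure {u, v, w} = ⊤)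
    (hu : f u = 1) (hvw : f v * f w = 1) : orderOf (f v) = Nat.card H := by
  have hle : (⊤ : Subgroup G) ≤ (Subgroup.zpowers (f v)).comap f := by
    rw [← hgen, Subgroup.closure_le]
    rintro g (rfl | rfl | rfl)
    · simp [hu]
    · simp
    · simp [eq_inv_of_mul_eq_one_right hvw]
  refine orderOf_eq_card_of_forall_mem_zpowers fun h => ?_
  obtain ⟨g, rfl⟩ := hf h
  exact hle (Subgroup.mem_top g)

/-- Generators `u`, `v`, `w` of a faithful metacyclic group with `u` in the kernel and `v * w`
trivial modulo the kernel: `u` has order `q`, while `v`, `w` lie outside the kernel and have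
order `n`. -/
theorem SemidirectProduct.orderOf_of_right_eq_one {q n : ℕ} [Fact q.Prime] (hn : 1 < n)
    {φ : Multiplicative (ZMod n) →* MulAut (Multiplicative (ZMod q))}
    (hφ : Function.Injective φ) {u v w : Multiplicative (ZMod q) ⋊[φ] Multiplicative (ZMod n)}
    (hu : u ≠ 1) (hgen : Subgroup.closure {u, v, w} = ⊤) (hur : u.right = 1)
    (hvw : v.right * w.right = 1) :
    v.right ≠ 1 ∧ w.right ≠ 1 ∧ orderOf u = q ∧ orderOf v = n ∧ orderOf w = n := by
  have hcard : Nat.card (Multiplicative (ZMod n)) = n := Nat.card_zmod n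
  have hN : Nat.card (Multiplicative (ZMod q)) = q := Nat.card_zmod q
  have outside : ∀ g : Multiplicative (ZMod q) ⋊[φ] Multiplicative (ZMod n),
      orderOf g.right = n → g.right ≠ 1 ∧ orderOf g = n := by
    intro g hg
    have hne : g.right ≠ 1 := fun h => by
      rw [h, orderOf_one] at hg
      omega
    refine ⟨hne, Nat.dvd_antisymm (orderOf_dvd_of_pow_eq_one
      (pow_eq_one_of_right_ne_one hφ hN hne (orderOf_dvd_iff_pow_eq_one.mp hg.dvd))) ?_⟩
    exact hg.symm.dvd.trans (orderOf_map_dvd rightHom g)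
  have hv : orderOf v.right = n :=
    (orderOf_map_eq_card_of_closure_eq_top rightHom_surjective hgen hur hvw).trans hcard
  have hw : orderOf w.right = n := by
    rw [eq_inv_of_mul_eq_one_right hvw, orderOf_inv, hv]
  obtain ⟨hv1, hvn⟩ := outside v hv
  obtain ⟨hw1, hwn⟩ := outside w hw
  refine ⟨hv1, hw1, ?_, hvn, hwn⟩
  obtain ⟨a, rfl⟩ := mem_range_inl_iff.mpr hur
  rw [orderOf_injective inl inl_injective]
  refine orderOf_eq_prime ?_ fun h => hu (by rw [h, map_one])
  exact orderOf_dvd_iff_pow_eq_one.mp ((orderOf_dvd_natCard a).trans hN.dvd)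

/-- Proposition 4.2: possible local monodromy for a spherical system of generators of a
faithful metacyclic group `G = (ℤ/qℤ) ⋊ (ℤ/nℤ)`. -/
theorem stmt7 (q n : ℕ) (hq : Nat.Prime q) (hn : 1 < n) (hdvd : n ∣ q - 1)
    (φ : Multiplicative (ZMod n) →* MulAut (Multiplicative (ZMod q)))
    (hφ : Function.Injective φ)
    (x y z : Multiplicative (ZMod q) ⋊[φ] Multiplicative (ZMod n))
    (hx : x ≠ 1) (hy : y ≠ 1) (hz : z ≠ 1)
    (hxyz : x * y * z = 1)
    (hgen : Subgroup.closure {x, y, z} = ⊤) :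
    (x ∈ SemidirectProduct.inl.range ∧ y ∉ SemidirectProduct.inl.range ∧
        z ∉ SemidirectProduct.inl.range ∧
        orderOf x = q ∧ orderOf y = n ∧ orderOf z = n) ∨
    (y ∈ SemidirectProduct.inl.range ∧ x ∉ SemidirectProduct.inl.range ∧
        z ∉ SemidirectProduct.inl.range ∧
        orderOf y = q ∧ orderOf x = n ∧ orderOf z = n) ∨
    (z ∈ SemidirectProduct.inl.range ∧ x ∉ SemidirectProduct.inl.range ∧
        y ∉ SemidirectProduct.inl.range ∧
        orderOf z = q ∧ orderOf x = n ∧ orderOf y = n) ∨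
    (x ∉ SemidirectProduct.inl.range ∧ y ∉ SemidirectProduct.inl.range ∧
        z ∉ SemidirectProduct.inl.range ∧
        orderOf x ∣ n ∧ orderOf y ∣ n ∧ orderOf z ∣ n) := by
  have : Fact q.Prime := ⟨hq⟩
  have hr : x.right * y.right * z.right = 1 := congrArg SemidirectProduct.right hxyz
  simp only [mem_range_inl_iff]
  by_cases hxr : x.right = 1
  · rw [hxr, one_mul] at hr
    exact Or.inl ⟨hxr, orderOf_of_right_eq_one hn hφ hx hgen hxr hr⟩
  by_cases hyr : y.right = 1
  · rw [hyr, mul_one] at hr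
    rw [Set.insert_comm] at hgen
    exact Or.inr (Or.inl ⟨hyr, orderOf_of_right_eq_one hn hφ hy hgen hyr hr⟩)
  by_cases hzr : z.right = 1
  · rw [hzr, mul_one] at hr
    rw [Set.pair_comm, Set.insert_comm] at hgen
    exact Or.inr (Or.inr (Or.inl ⟨hzr, orderOf_of_right_eq_one hn hφ hz hgen hzr hr⟩))
  have dvd : ∀ g : Multiplicative (ZMod q) ⋊[φ] Multiplicative (ZMod n),
      g.right ≠ 1 → orderOf g ∣ n := fun g hg =>
    orderOf_dvd_of_pow_eq_one (pow_eq_one_of_right_ne_one hφ (Nat.card_zmod q) hg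
      (orderOf_dvd_iff_pow_eq_one.mp ((orderOf_dvd_natCard g.right).trans (Nat.card_zmod n).dvd)))
  exact Or.inr (Or.inr (Or.inr ⟨hxr, hyr, hzr, dvd x hxr, dvd y hyr, dvd z hzr⟩))
end

section
/- The faithful metacyclic group G = (ℤ/qℤ) ⋊ (ℤ/nℤ) has exactly n + (q − 1)/n conjugacy classes. -/
namespace SemidirectProduct

variable {N H : Type*} [CommGroup N] [CommGroup H] {φ : H →* MulAut N}

/-- Commutation in a semidirect product of commutative groups. -/
theorem commute_iff_of_comm (x y : N ⋊[φ] H) :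
    Commute x y ↔ x.left * φ x.right y.left = y.left * φ y.right x.left := by
  simp [Commute, SemiconjBy, SemidirectProduct.ext_iff, mul_comm x.right]

/-- Commuting pairs of a semidirect product of commutative groups, fibred over the pairs of
right components. -/
def commutePairsEquiv (φ : H →* MulAut N) :
    {p : (N ⋊[φ] H) × (N ⋊[φ] H) // Commute p.1 p.2} ≃
      Σ r : H × H, {p : N × N // p.1 * φ r.1 p.2 = p.2 * φ r.2 p.1} where
  toFun p := ⟨(p.1.1.right, p.1.2.right), (p.1.1.left, p.1.2.left),
    (commute_iff_of_comm _ _).1 p.2⟩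
  invFun s := ⟨(⟨s.2.1.1, s.1.1⟩, ⟨s.2.1.2, s.1.2⟩), (commute_iff_of_comm _ _).2 s.2.2⟩
  left_inv _ := rfl
  right_inv _ := rfl

/-- A fixed-point-free automorphism `f` of a finite commutative group makes `a ↦ f a / a`
bijective. -/
theorem bijective_div_of_fixedPointFree [Finite N] (f : MulAut N)
    (hf : ∀ a, f a = a → a = 1) : Function.Bijective fun a ↦ f a / a := by
  refine Finite.injective_iff_bijective.1 fun a b hab ↦ div_eq_one.1 (hf _ ?_)
  rw [map_div, div_eq_div_iff_div_eq_div]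
  simpa using hab

theorem card_commuting_left_of_fixedPointFree [Finite N] (f g : MulAut N)
    (hf : ∀ a, f a = a → a = 1) :
    Nat.card {p : N × N // p.1 * f p.2 = p.2 * g p.1} = Nat.card N := by
  have hiff (a b : N) : a * f b = b * g a ↔ f b / b = g a / a := by
    rw [div_eq_div_iff_mul_eq_mul, mul_comm a, mul_comm b]
  have hbij := bijective_div_of_fixedPointFree f hf
  refine Nat.card_eq_of_bijective (fun p ↦ p.1.1) ⟨?_, fun a ↦ ?_⟩
  · rintro ⟨⟨a, b⟩, h⟩ ⟨⟨a', c⟩, h'⟩ (rfl : a = a')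
    obtain rfl : b = c := hbij.injective (((hiff a b).1 h).trans ((hiff a c).1 h').symm)
    rfl
  · obtain ⟨b, hb⟩ := hbij.surjective (g a / a)
    exact ⟨⟨(a, b), (hiff a b).2 hb⟩, rfl⟩

theorem card_commuting_left [Finite N] (hφ : ∀ h ≠ 1, ∀ a, φ h a = a → a = 1)
    {r : H × H} (hr : r ≠ 1) :
    Nat.card {p : N × N // p.1 * φ r.1 p.2 = p.2 * φ r.2 p.1} = Nat.card N := by
  by_cases h : r.1 = 1
  · have h2 : r.2 ≠ 1 := fun h2 ↦ hr (Prod.ext h h2)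
    rw [← card_commuting_left_of_fixedPointFree (φ r.2) (φ r.1) (hφ _ h2)]
    exact Nat.card_congr ((Equiv.prodComm N N).subtypeEquiv fun p ↦ eq_comm)
  · exact card_commuting_left_of_fixedPointFree _ _ (hφ _ h)

/-- The class number of a Frobenius group with commutative kernel and complement. -/
theorem card_conjClasses_mul_card_add_one [Finite N] [Finite H]
    (hφ : ∀ h ≠ 1, ∀ a, φ h a = a → a = 1) :
    Nat.card (ConjClasses (N ⋊[φ] H)) * Nat.card H + 1 = Nat.card N + Nat.card H ^ 2 := by
  classical
  have := Fintype.ofFinite H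
  have hcomm := card_comm_eq_card_conjClasses_mul_card (N ⋊[φ] H)
  rw [Nat.card_congr (commutePairsEquiv φ), Nat.card_sigma, SemidirectProduct.card,
    ← Finset.add_sum_erase _ _ (Finset.mem_univ 1),
    Finset.sum_congr rfl fun r hr ↦ card_commuting_left hφ (Finset.ne_of_mem_erase hr)] at hcomm
  have hone : Nat.card {p : N × N // p.1 * φ (1 : H × H).1 p.2 = p.2 * φ (1 : H × H).2 p.1} =
      Nat.card N * Nat.card N := by
    rw [← Nat.card_prod]
    exact Nat.card_congr (Equiv.subtypeUnivEquiv fun p ↦ by simp [mul_comm])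
  have hpos : 0 < Nat.card N := Nat.card_pos
  have hcard : (Finset.univ.erase (1 : H × H)).card + 1 = Nat.card H ^ 2 := by
    rw [Finset.card_erase_add_one (Finset.mem_univ _), Finset.card_univ, Fintype.card_prod,
      Nat.card_eq_fintype_card, sq]
  rw [hone, Finset.sum_const, smul_eq_mul] at hcomm
  refine Nat.eq_of_mul_eq_mul_left hpos ?_
  rw [← hcard]
  linear_combination -hcomm

end SemidirectProduct

/-- An automorphism of a group of prime order with a nontrivial fixed point is trivial. -/
theorem MulAut.eq_one_of_prime_card {N : Type*} [Group N] {p : ℕ} [Fact p.Prime]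
    (hN : Nat.card N = p) {f : MulAut N} {a : N} (ha : a ≠ 1) (hfa : f a = a) : f = 1 := by
  ext b
  obtain ⟨k, rfl⟩ := mem_zpowers_of_prime_card hN (g := a) (g' := b) ha
  simp [hfa]

/-- The faithful metacyclic group `G = (ℤ/qℤ) ⋊ (ℤ/nℤ)` has exactly `n + (q − 1)/n`
conjugacy classes. -/
theorem stmt8 (q n : ℕ) (hq : Nat.Prime q) (hn : 1 < n) (hdvd : n ∣ q - 1)
    (φ : Multiplicative (ZMod n) →* MulAut (Multiplicative (ZMod q)))
    (hφ : Function.Injective φ) :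
    Nat.card (ConjClasses (Multiplicative (ZMod q) ⋊[φ] Multiplicative (ZMod n)))
      = n + (q - 1) / n := by
  have : Fact q.Prime := ⟨hq⟩
  have : NeZero n := ⟨by omega⟩
  have hN : Nat.card (Multiplicative (ZMod q)) = q := by simp
  have hH : Nat.card (Multiplicative (ZMod n)) = n := by simp
  have hcard := SemidirectProduct.card_conjClasses_mul_card_add_one (φ := φ) fun h hh a ha ↦ by
    by_contra hne
    exact hh (hφ ((MulAut.eq_one_of_prime_card hN hne ha).trans φ.map_one.symm))
  rw [hN, hH] at hcard
  obtain ⟨m, hm⟩ := hdvd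
  have hq1 : q = n * m + 1 := by have := hq.pos; omega
  rw [hm, Nat.mul_div_cancel_left m (by omega)]
  refine Nat.eq_of_mul_eq_mul_right (show 0 < n by omega) ?_
  linear_combination hcard + hq1
end

section
/- Let q be an odd prime and let x, y, z be non-identity elements of the dicyclic group Dic_q of order 4q such that x·y·z = 1 and x, y, z generate Dic_q. Then the multiset of orders {ord(x), ord(y), ord(z)} is either {q, 4, 4} or {2q, 4, 4}. -/
namespace QuaternionGroup

variable {n : ℕ}

lemma two_mul_natCast_self : (2 : ZMod (2 * n)) * n = 0 := by
  exact_mod_cast ZMod.natCast_self (2 * n)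

/-- The cyclic subgroup of the rotations `a i` in the dicyclic group. -/
def rotations (n : ℕ) : Subgroup (QuaternionGroup n) where
  carrier := Set.range a
  mul_mem' := by
    rintro _ _ ⟨i, rfl⟩ ⟨j, rfl⟩
    exact ⟨i + j, rfl⟩
  one_mem' := ⟨0, rfl⟩
  inv_mem' := by
    rintro _ ⟨i, rfl⟩
    exact ⟨-i, rfl⟩

lemma rotations_ne_top : rotations n ≠ ⊤ := by
  intro h
  have h0 : xa 0 ∈ rotations n := h ▸ Subgroup.mem_top _
  obtain ⟨i, hi⟩ := h0
  cases hi

/-- The subgroup generated by `xa j` and the rotations of order dividing two. -/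
def xaSubgroup (j : ZMod (2 * n)) : Subgroup (QuaternionGroup n) where
  carrier := {g | (∃ i, 2 * i = 0 ∧ g = a i) ∨ ∃ i, 2 * i = 2 * j ∧ g = xa i}
  mul_mem' := by
    have hn := two_mul_natCast_self (n := n)
    rintro _ _ (⟨i, hi, rfl⟩ | ⟨i, hi, rfl⟩) (⟨k, hk, rfl⟩ | ⟨k, hk, rfl⟩)
    · exact Or.inl ⟨i + k, by linear_combination hi + hk, rfl⟩
    · exact Or.inr ⟨k - i, by linear_combination hk - hi, rfl⟩
    · exact Or.inr ⟨i + k, by linear_combination hi + hk, rfl⟩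
    · exact Or.inl ⟨n + k - i, by linear_combination hn + hk - hi, rfl⟩
  one_mem' := Or.inl ⟨0, mul_zero 2, rfl⟩
  inv_mem' := by
    have hn := two_mul_natCast_self (n := n)
    rintro _ (⟨i, hi, rfl⟩ | ⟨i, hi, rfl⟩)
    · exact Or.inl ⟨-i, by linear_combination -hi, rfl⟩
    · exact Or.inr ⟨n + i, by linear_combination hn + hi, rfl⟩

lemma a_mem_xaSubgroup {i j : ZMod (2 * n)} : a i ∈ xaSubgroup j ↔ 2 * i = 0 := by
  refine ⟨?_, fun h => Or.inl ⟨i, h, rfl⟩⟩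
  rintro (⟨k, hk, h⟩ | ⟨k, hk, h⟩)
  · cases h
    exact hk
  · cases h

lemma xa_mem_xaSubgroup {i j : ZMod (2 * n)} (h : 2 * i = 2 * j) : xa i ∈ xaSubgroup j :=
  Or.inr ⟨i, h, rfl⟩

lemma xaSubgroup_ne_top (hn : n ≠ 1) (j : ZMod (2 * n)) : xaSubgroup j ≠ ⊤ := by
  intro h
  have h1 : a 1 ∈ xaSubgroup j := h ▸ Subgroup.mem_top _
  rw [a_mem_xaSubgroup, mul_one] at h1
  have h2 : 2 * n ∣ 2 * 1 := (ZMod.natCast_eq_zero_iff _ _).mp (by exact_mod_cast h1)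
  exact hn (Nat.dvd_one.mp (Nat.dvd_of_mul_dvd_mul_left two_pos h2))

lemma orderOf_a_eq_of_prime (hn : n.Prime) {i : ZMod (2 * n)} (hi : 2 * i ≠ 0) :
    orderOf (a i) = n ∨ orderOf (a i) = 2 * n := by
  have : NeZero n := ⟨hn.ne_zero⟩
  have hsq : ¬ orderOf (a i) ∣ 2 := by
    rw [orderOf_dvd_iff_pow_eq_one, sq, a_mul_a, one_def]
    intro h
    exact hi ((two_mul i).trans (a.inj h))
  have hdvd : orderOf (a i) ∣ 2 * n := by
    rw [orderOf_a]
    exact Nat.div_dvd_of_dvd (Nat.gcd_dvd_left _ _)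
  obtain ⟨d, e, hd, he, h⟩ := (Nat.dvd_mul).mp hdvd
  rcases (Nat.dvd_prime hn).mp he with rfl | rfl
  · exact absurd (by simpa [← h] using hd) hsq
  · rcases (Nat.dvd_prime Nat.prime_two).mp hd with rfl | rfl
    · exact Or.inl (by simpa using h.symm)
    · exact Or.inr h.symm

end QuaternionGroup

open QuaternionGroup in
/-- Proposition 5.1: local monodromy of a spherical system of generators of the dicyclic
group `Dic_q` (for `q` an odd prime) is `(q, 4, 4)` or `(2q, 4, 4)` up to permutation. -/
theorem stmt9 (q : ℕ) (hq : Nat.Prime q) (hodd : Odd q)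
    (x y z : QuaternionGroup q)
    (hx : x ≠ 1) (hy : y ≠ 1) (hz : z ≠ 1)
    (hxyz : x * y * z = 1)
    (hgen : Subgroup.closure {x, y, z} = ⊤) :
    ({orderOf x, orderOf y, orderOf z} : Multiset ℕ) = {q, 4, 4} ∨
    ({orderOf x, orderOf y, orderOf z} : Multiset ℕ) = {2 * q, 4, 4} := by
  have : NeZero q := ⟨hq.ne_zero⟩
  have hn := two_mul_natCast_self (n := q)
  have hout (S : Subgroup (QuaternionGroup q)) (hS : S ≠ ⊤) (h1 : x ∈ S) (h2 : y ∈ S)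
      (h3 : z ∈ S) : False := by
    refine hS (top_le_iff.mp (hgen ▸ (Subgroup.closure_le S).mpr ?_))
    rintro _ (rfl | rfl | rfl) <;> assumption
  rcases x with i | i <;> rcases y with j | j <;> rcases z with k | k <;>
    simp only [a_mul_a, a_mul_xa, xa_mul_a, xa_mul_xa, one_def, a.injEq, reduceCtorEq] at hxyz
  · exact (hout _ rotations_ne_top ⟨i, rfl⟩ ⟨j, rfl⟩ ⟨k, rfl⟩).elim
  · have hi : 2 * i ≠ 0 := fun h => hout _ (xaSubgroup_ne_top hq.ne_one j)
      (a_mem_xaSubgroup.mpr h) (xa_mem_xaSubgroup rfl)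
      (xa_mem_xaSubgroup (by linear_combination 2 * hxyz - hn - h))
    rw [orderOf_xa, orderOf_xa]
    exact (orderOf_a_eq_of_prime hq hi).imp (fun h => by rw [h]) (fun h => by rw [h])
  · have hj : 2 * j ≠ 0 := fun h => hout _ (xaSubgroup_ne_top hq.ne_one i)
      (xa_mem_xaSubgroup rfl) (a_mem_xaSubgroup.mpr h)
      (xa_mem_xaSubgroup (by linear_combination 2 * hxyz - hn + h))
    rw [orderOf_xa, orderOf_xa, Multiset.insert_eq_cons, Multiset.insert_eq_cons,
      Multiset.cons_swap]
    exact (orderOf_a_eq_of_prime hq hj).imp (fun h => by rw [h]; rfl) (fun h => by rw [h]; rfl)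
  · have hk : 2 * k ≠ 0 := fun h => hout _ (xaSubgroup_ne_top hq.ne_one i)
      (xa_mem_xaSubgroup rfl) (xa_mem_xaSubgroup (by linear_combination 2 * hxyz - hn - h))
      (a_mem_xaSubgroup.mpr h)
    rw [orderOf_xa, orderOf_xa, Multiset.pair_comm 4, Multiset.insert_eq_cons,
      Multiset.insert_eq_cons, Multiset.cons_swap]
    exact (orderOf_a_eq_of_prime hq hk).imp (fun h => by rw [h]; rfl) (fun h => by rw [h]; rfl)
end

section
/- The class function χ_t has norm 1: (1/(4q)) · Σ_{g ∈ Dic_q} χ_t(g) · conj(χ_t(g)) = 1. (This reflects that ψ₁ ⊗ ρ_t is an irreducible representation of Dic_q.) -/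
open scoped BigOperators

theorem ZMod.sum_val_eq_sum_range {M : Type*} [AddCommMonoid M] (n : ℕ) [NeZero n] (f : ℕ → M) :
    ∑ x : ZMod n, f x.val = ∑ i ∈ Finset.range n, f i := by
  obtain ⟨k, rfl⟩ := Nat.exists_eq_succ_of_ne_zero (NeZero.ne n)
  exact Fin.sum_univ_eq_sum_range f (k + 1)

/-- The dicyclic group is the disjoint union of its cyclic subgroup and the other coset. -/
def QuaternionGroup.sumEquiv (n : ℕ) : ZMod (2 * n) ⊕ ZMod (2 * n) ≃ QuaternionGroup n where
  toFun := Sum.elim QuaternionGroup.a QuaternionGroup.xa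
  invFun
    | .a i => .inl i
    | .xa i => .inr i
  left_inv := by rintro (i | i) <;> rfl
  right_inv := by rintro (i | i) <;> rfl

theorem QuaternionGroup.sum_eq {M : Type*} [AddCommMonoid M] (n : ℕ) [NeZero n]
    (f : QuaternionGroup n → M) :
    ∑ g, f g = ∑ i, f (QuaternionGroup.a i) + ∑ i, f (QuaternionGroup.xa i) := by
  rw [← (QuaternionGroup.sumEquiv n).sum_comp, Fintype.sum_sum_type]
  rfl

theorem geom_sum_eq_zero_of_pow_eq_one {K : Type*} [Field K] {x : K} {n : ℕ} (hx : x ≠ 1)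
    (h : x ^ n = 1) : ∑ i ∈ Finset.range n, x ^ i = 0 := by
  rw [geom_sum_eq hx, h, sub_self, zero_div]

/-- The squared norm of `k ↦ w ^ k + w ^ (-k)`, summed over a period of a root of unity `w`. -/
theorem sum_pow_add_inv_mul_conj {w : ℂ} {n : ℕ} (hn : n ≠ 0) (hw : w ^ n = 1)
    (hw2 : w ^ 2 ≠ 1) :
    ∑ k ∈ Finset.range n, (w ^ k + (w ^ k)⁻¹) * (starRingEnd ℂ) (w ^ k + (w ^ k)⁻¹) = 2 * n := by
  have hconj : (starRingEnd ℂ) w = w⁻¹ :=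
    (Complex.inv_eq_conj (Complex.norm_eq_one_of_pow_eq_one hw hn)).symm
  have hw0 : w ≠ 0 := by
    rintro rfl
    simp [hn] at hw
  have hterm (k : ℕ) : (w ^ k + (w ^ k)⁻¹) * (starRingEnd ℂ) (w ^ k + (w ^ k)⁻¹)
      = (w ^ 2) ^ k + ((w ^ 2)⁻¹) ^ k + 2 := by
    have hz : w ^ k ≠ 0 := pow_ne_zero k hw0
    rw [map_add, map_inv₀, map_pow, hconj, inv_pow, inv_inv, inv_pow, pow_right_comm w 2 k]
    field_simp
    ring
  have hpow : (w ^ 2) ^ n = 1 := by rw [pow_right_comm, hw, one_pow]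
  simp_rw [hterm, Finset.sum_add_distrib]
  rw [geom_sum_eq_zero_of_pow_eq_one hw2 hpow,
    geom_sum_eq_zero_of_pow_eq_one (inv_ne_one.mpr hw2) (by rw [inv_pow, hpow, inv_one])]
  simp [mul_comm]

/-- The class function `χ_t = ψ₁ ⊗ χ_t` of the dicyclic group `Dic_q` has norm `1`,
reflecting irreducibility of `ψ₁ ⊗ ρ_t`. -/
theorem stmt12 (q : ℕ) [NeZero q] (hq : Nat.Prime q) (hodd : Odd q)
    (t : ℕ) (ht1 : 1 ≤ t) (ht2 : t ≤ (q - 1) / 2)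
    (ζ : ℂ) (hζ : ζ = Complex.exp (2 * Real.pi * Complex.I / (2 * q)))
    (χ : QuaternionGroup q → ℂ)
    (hχa : ∀ ν : ZMod (2 * q),
      χ (QuaternionGroup.a ν)
        = ζ ^ (((2 * t - 1) * ν.val : ℕ) : ℤ) + ζ ^ (-(((2 * t - 1) * ν.val : ℕ) : ℤ)))
    (hχxa : ∀ ν : ZMod (2 * q), χ (QuaternionGroup.xa ν) = 0) :
    (1 / (4 * q : ℂ)) * ∑ g : QuaternionGroup q, χ g * (starRingEnd ℂ) (χ g) = 1 := by
  have hq0 : q ≠ 0 := NeZero.ne q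
  have hprim : IsPrimitiveRoot ζ (2 * q) := by
    have h := Complex.isPrimitiveRoot_exp (2 * q) (NeZero.ne _)
    push_cast at h
    rwa [hζ]
  have hw : (ζ ^ (2 * t - 1)) ^ (2 * q) = 1 := by
    rw [pow_right_comm, hprim.pow_eq_one, one_pow]
  have hw2 : (ζ ^ (2 * t - 1)) ^ 2 ≠ 1 := by
    rw [← pow_mul, Ne, hprim.pow_eq_one_iff_dvd, mul_comm, Nat.mul_dvd_mul_iff_right two_pos]
    intro h
    have := Nat.le_of_dvd (by lia) h
    lia
  have hsum := sum_pow_add_inv_mul_conj (NeZero.ne (2 * q)) hw hw2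
  rw [QuaternionGroup.sum_eq]
  simp only [hχxa, hχa, zpow_neg, zpow_natCast, pow_mul, zero_mul, Finset.sum_const_zero, add_zero]
  rw [ZMod.sum_val_eq_sum_range (2 * q) fun k ↦ ((ζ ^ (2 * t - 1)) ^ k + ((ζ ^ (2 * t - 1)) ^ k)⁻¹) *
    (starRingEnd ℂ) ((ζ ^ (2 * t - 1)) ^ k + ((ζ ^ (2 * t - 1)) ^ k)⁻¹), hsum]
  have : (q : ℂ) ≠ 0 := Nat.cast_ne_zero.mpr hq0
  push_cast
  field_simp
  norm_num
end

section
/- There is an isomorphism of ℚ-algebras between the rational group algebra ℚ[Q₈] of the quaternion group Q₈ and the product ℚ × ℚ × ℚ × ℚ × ℍ_ℚ, where ℍ_ℚ denotes the rational Hamilton quaternions (the quaternion algebra over ℚ with i² = j² = −1). -/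
/-- The homomorphism out of the generalised quaternion group
`⟨a, x | a ^ (2 * n) = 1, x ^ 2 = a ^ n, a * x * a = x⟩` determined by the images `u` of `a` and
`v` of `x`. -/
def QuaternionGroup.liftOfRelations {n : ℕ} [NeZero n] {M : Type*} [Monoid M] (u v : M)
    (hu : u ^ (2 * n) = 1) (hv : v * v = u ^ n) (huv : u * v * u = v) :
    QuaternionGroup n →* M where
  toFun
    | a i => u ^ i.val
    | xa i => v * u ^ i.val
  map_one' := by simp [one_def, -a_zero]
  map_mul' := by
    have hadd (i j : ZMod (2 * n)) : u ^ (i + j).val = u ^ i.val * u ^ j.val := by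
      rw [ZMod.val_add, ← pow_eq_pow_mod _ hu, pow_add]
    have hcast : u ^ (n : ZMod (2 * n)).val = u ^ n := by
      rw [ZMod.val_natCast, ← pow_eq_pow_mod _ hu]
    have hconj (k : ℕ) : u ^ k * v * u ^ k = v := by
      induction k with
      | zero => simp
      | succ k ih =>
        calc u ^ (k + 1) * v * u ^ (k + 1) = u ^ k * (u * v * u) * u ^ k := by
              rw [pow_succ]; nth_rewrite 2 [← pow_succ]; rw [pow_succ']; simp only [mul_assoc]
          _ = v := by rw [huv, ih]
    have hswap (i k : ZMod (2 * n)) : u ^ i.val * (v * u ^ (i + k).val) = v * u ^ k.val := by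
      rw [hadd, ← mul_assoc, ← mul_assoc, hconj]
    rintro (i | i) (j | j)
    · exact hadd i j
    · obtain ⟨k, rfl⟩ : ∃ k, j = i + k := ⟨j - i, by ring⟩
      simp [hswap]
    · simp [hadd, mul_assoc]
    · obtain ⟨k, rfl⟩ : ∃ k, j = i + k := ⟨j - i, by ring⟩
      rw [xa_mul_xa, show (n : ZMod (2 * n)) + (i + k) - i = n + k by ring]
      simp only [hadd (n : ZMod (2 * n)), hcast, mul_assoc, hswap]
      rw [← mul_assoc, hv]

/-- The rational Hamilton quaternion `i`. -/
def ratQuaternionI : Quaternion ℚ := ⟨0, 1, 0, 0⟩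

/-- The rational Hamilton quaternion `j`. -/
def ratQuaternionJ : Quaternion ℚ := ⟨0, 0, 1, 0⟩

@[simp] theorem re_ratQuaternionI : ratQuaternionI.re = 0 := rfl
@[simp] theorem imI_ratQuaternionI : ratQuaternionI.imI = 1 := rfl
@[simp] theorem imJ_ratQuaternionI : ratQuaternionI.imJ = 0 := rfl
@[simp] theorem imK_ratQuaternionI : ratQuaternionI.imK = 0 := rfl

@[simp] theorem re_ratQuaternionJ : ratQuaternionJ.re = 0 := rfl
@[simp] theorem imI_ratQuaternionJ : ratQuaternionJ.imI = 0 := rfl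
@[simp] theorem imJ_ratQuaternionJ : ratQuaternionJ.imJ = 1 := rfl
@[simp] theorem imK_ratQuaternionJ : ratQuaternionJ.imK = 0 := rfl

theorem ratQuaternionI_sq : ratQuaternionI ^ 2 = -1 := by
  rw [sq]
  ext <;> simp [Quaternion.re_one, Quaternion.imI_one, Quaternion.imJ_one,
    Quaternion.imK_one]

theorem ratQuaternionI_pow_three : ratQuaternionI ^ 3 = -ratQuaternionI := by
  rw [pow_succ, ratQuaternionI_sq, neg_one_mul]

theorem ratQuaternionJ_mul_self : ratQuaternionJ * ratQuaternionJ = -1 := by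
  ext <;> simp [Quaternion.re_one, Quaternion.imI_one, Quaternion.imJ_one,
    Quaternion.imK_one]

theorem ratQuaternionI_mul_J_mul_I :
    ratQuaternionI * ratQuaternionJ * ratQuaternionI = ratQuaternionJ := by
  ext <;> simp

/-- The four linear characters of `Q₈` together with its embedding into the Hamilton quaternions
sending `a 1` to `i` and `xa 0` to `j`. -/
def quaternionGroupTwoRep : QuaternionGroup 2 →* ℚ × ℚ × ℚ × ℚ × Quaternion ℚ :=
  QuaternionGroup.liftOfRelations (1, 1, -1, -1, ratQuaternionI) (1, -1, 1, -1, ratQuaternionJ)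
    (by rw [pow_mul]; simp [ratQuaternionI_sq])
    (by simp [ratQuaternionI_sq, ratQuaternionJ_mul_self])
    (by simp [ratQuaternionI_mul_J_mul_I])

open QuaternionGroup in
theorem lift_quaternionGroupTwoRep_injective :
    Function.Injective (MonoidAlgebra.lift ℚ _ _ quaternionGroupTwoRep) := by
  rw [injective_iff_map_eq_zero]
  intro f hf
  have huniv : (Finset.univ : Finset (QuaternionGroup 2)) =
      {a 0, a 1, a 2, a 3, xa 0, xa 1, xa 2, xa 3} := by decide
  have h0 : ZMod.val (0 : ZMod (2 * 2)) = 0 := rfl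
  have h1 : ZMod.val (1 : ZMod (2 * 2)) = 1 := rfl
  have h2 : ZMod.val (2 : ZMod (2 * 2)) = 2 := rfl
  have h3 : ZMod.val (3 : ZMod (2 * 2)) = 3 := rfl
  rw [MonoidAlgebra.lift_apply, Finsupp.sum_fintype _ _ (by simp), huniv] at hf
  repeat rw [Finset.sum_insert (by decide)] at hf
  rw [Finset.sum_singleton] at hf
  simp only [quaternionGroupTwoRep, liftOfRelations, MonoidHom.coe_mk, OneHom.coe_mk, h0, h1, h2,
    h3, Prod.pow_mk, Prod.mk_mul_mk, pow_zero, pow_one, ratQuaternionI_sq,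
    ratQuaternionI_pow_three, Prod.ext_iff, Quaternion.ext_iff] at hf
  norm_num [-a_zero, Quaternion.re_zero, Quaternion.imI_zero, Quaternion.imJ_zero,
    Quaternion.imK_zero] at hf
  obtain ⟨e1, e2, e3, e4, e5, e6, e7, e8⟩ := hf
  have key : ∀ g ∈ (Finset.univ : Finset (QuaternionGroup 2)), f.coeff g = 0 := by
    rw [huniv]
    simp only [Finset.mem_insert, Finset.mem_singleton]
    rintro g (rfl | rfl | rfl | rfl | rfl | rfl | rfl | rfl) <;> linarith
  ext g
  simpa using key g (Finset.mem_univ g)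

/-- The rational group algebra of the quaternion group `Q₈` is isomorphic, as a
`ℚ`-algebra, to `ℚ × ℚ × ℚ × ℚ × ℍ_ℚ`, where `ℍ_ℚ` is the algebra of rational
Hamilton quaternions. -/
theorem stmt15 :
    Nonempty (MonoidAlgebra ℚ (QuaternionGroup 2) ≃ₐ[ℚ]
      (ℚ × ℚ × ℚ × ℚ × Quaternion ℚ)) := by
  have hinj := lift_quaternionGroupTwoRep_injective
  have hdim : Module.finrank ℚ (MonoidAlgebra ℚ (QuaternionGroup 2)) =
      Module.finrank ℚ (ℚ × ℚ × ℚ × ℚ × Quaternion ℚ) := by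
    rw [(MonoidAlgebra.coeffLinearEquiv ℚ).finrank_eq]
    simp [Quaternion.finrank_eq_four, QuaternionGroup.card]
  have : Module.Finite ℚ (MonoidAlgebra ℚ (QuaternionGroup 2)) :=
    Module.Finite.equiv (MonoidAlgebra.coeffLinearEquiv ℚ).symm
  have hsurj : Function.Surjective (MonoidAlgebra.lift ℚ _ _ quaternionGroupTwoRep) :=
    (LinearMap.injective_iff_surjective_of_finrank_eq_finrank hdim
      (f := (MonoidAlgebra.lift ℚ _ _ quaternionGroupTwoRep).toLinearMap)).mp hinj
  exact ⟨AlgEquiv.ofBijective _ ⟨hinj, hsurj⟩⟩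
end

section
/- Let K = ℚ(ζ₄) be the fourth cyclotomic field. There is an isomorphism of K-algebras between the group algebra K[Q₈] of the quaternion group Q₈ and the product K × K × K × K × M₂(K), where M₂(K) is the algebra of 2×2 matrices over K. -/
/-- The homomorphism out of `Q₈` determined by images `x, y` of the generators `a 1` and `xa 0`
that satisfy the defining relations. -/
def quaternionGroupLift {R : Type*} [Monoid R] (x y : R) (hx : x ^ 4 = 1) (hy : y * y = x ^ 2)
    (hxy : x * y = y * x ^ 3) : QuaternionGroup 2 →* R where
  toFun
    | .a j => x ^ j.val
    | .xa j => y * x ^ j.val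
  map_one' := pow_zero x
  map_mul' := by
    have hadd (i j : ZMod (2 * 2)) : x ^ (i + j).val = x ^ i.val * x ^ j.val := by
      rw [ZMod.val_add, ← pow_add]
      exact (pow_eq_pow_mod _ hx).symm
    have hneg (i : ZMod (2 * 2)) : x ^ i.val * y = y * x ^ (-i).val := by
      have hconj : SemiconjBy y (x ^ 3) x := hxy.symm
      rw [← (hconj.pow_right i.val).eq, ← pow_mul, pow_eq_pow_mod _ hx]
      congr 2
      revert i
      decide
    have htwo : x ^ (2 : ZMod (2 * 2)).val = x ^ 2 := rfl
    rintro (i | i) (j | j)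
    · exact hadd i j
    · simp only [QuaternionGroup.a_mul_xa]
      rw [sub_eq_neg_add, hadd, ← mul_assoc, ← hneg, mul_assoc]
    · simp only [QuaternionGroup.xa_mul_a]
      rw [hadd, mul_assoc]
    · simp only [QuaternionGroup.xa_mul_xa]
      have h : ((2 : ℕ) : ZMod (2 * 2)) + j - i = 2 + (-i + j) := by push_cast; ring
      rw [h, hadd, hadd, htwo, ← hy, mul_assoc y (x ^ i.val), ← mul_assoc (x ^ i.val), hneg]
      simp only [mul_assoc]

@[simp]
theorem quaternionGroupLift_a {R : Type*} [Monoid R] (x y : R) (hx : x ^ 4 = 1)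
    (hy : y * y = x ^ 2) (hxy : x * y = y * x ^ 3) (j : ZMod (2 * 2)) :
    quaternionGroupLift x y hx hy hxy (.a j) = x ^ j.val := rfl

@[simp]
theorem quaternionGroupLift_xa {R : Type*} [Monoid R] (x y : R) (hx : x ^ 4 = 1)
    (hy : y * y = x ^ 2) (hxy : x * y = y * x ^ 3) (j : ZMod (2 * 2)) :
    quaternionGroupLift x y hx hy hxy (.xa j) = y * x ^ j.val := rfl

theorem sum_quaternionGroup_two {M : Type*} [AddCommMonoid M] (F : QuaternionGroup 2 → M) :
    ∑ g, F g = (F (.a 0) + F (.a 1) + F (.a 2) + F (.a 3)) +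
      (F (.xa 0) + F (.xa 1) + F (.xa 2) + F (.xa 3)) := by
  have h : (Finset.univ : Finset (QuaternionGroup 2)) =
      {.a 0, .a 1, .a 2, .a 3, .xa 0, .xa 1, .xa 2, .xa 3} := by decide
  rw [h]
  repeat rw [Finset.sum_insert (by decide)]
  rw [Finset.sum_singleton]
  simp only [add_assoc]

/-- Over a field of characteristic not two containing a square root of `-1`, the group algebra of
`Q₈` splits. -/
theorem nonempty_monoidAlgebra_quaternionGroup_two_algEquiv {K : Type*} [Field K] (i : K)
    (hi : i * i = -1) (h_two : (2 : K) ≠ 0) :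
    Nonempty (MonoidAlgebra K (QuaternionGroup 2) ≃ₐ[K]
      (K × K × K × K × Matrix (Fin 2) (Fin 2) K)) := by
  let x : K × K × K × K × Matrix (Fin 2) (Fin 2) K := (1, 1, -1, -1, !![i, 0; 0, -i])
  let y : K × K × K × K × Matrix (Fin 2) (Fin 2) K := (1, -1, 1, -1, !![0, -1; 1, 0])
  have hx2 : x ^ 2 = (1, 1, 1, 1, !![-1, 0; 0, -1]) := by simp [x, sq, hi]
  have hx3 : x ^ 3 = (1, 1, -1, -1, !![-i, 0; 0, i]) := by
    rw [pow_succ, hx2]; simp [x]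
  have hx4 : x ^ 4 = 1 := by
    rw [pow_succ, hx3]
    simp [x, hi, Matrix.one_fin_two, Prod.ext_iff]
  have hy : y * y = x ^ 2 := by rw [hx2]; simp [y]
  have hxy : x * y = y * x ^ 3 := by rw [hx3]; simp [x, y]
  let φ := MonoidAlgebra.lift K _ _ (quaternionGroupLift x y hx4 hy hxy)
  have hφ : Function.Injective φ.toLinearMap := by
    rw [← LinearMap.ker_eq_bot, LinearMap.ker_eq_bot']
    intro f hf
    have hsum : φ f = ∑ g, f.coeff g • quaternionGroupLift x y hx4 hy hxy g := by
      rw [MonoidAlgebra.lift_apply, Finsupp.sum_fintype _ _ (by simp)]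
    change φ f = 0 at hf
    have v1 : (1 : ZMod (2 * 2)).val = 1 := rfl
    have v2 : (2 : ZMod (2 * 2)).val = 2 := rfl
    have v3 : (3 : ZMod (2 * 2)).val = 3 := rfl
    rw [hsum, sum_quaternionGroup_two] at hf
    simp only [quaternionGroupLift_a, quaternionGroupLift_xa, ZMod.val_zero, v1, v2, v3,
      pow_zero, pow_one, hx2, hx3] at hf
    simp only [x, y, Prod.ext_iff, ← Matrix.ext_iff, Fin.forall_fin_two] at hf
    simp [-QuaternionGroup.a_zero] at hf
    obtain ⟨h1, h2, h3, h4, ⟨h5, h6⟩, h7, h8⟩ := hf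
    have key (c : K) (h : 2 * (2 * (2 * c)) = 0) : c = 0 := by simpa [h_two] using h
    ext g
    rw [MonoidAlgebra.coeff_zero, Finsupp.zero_apply]
    apply key
    rcases g with j | j <;> fin_cases j
    · change 2 * (2 * (2 * f.coeff (.a 0))) = 0
      linear_combination h1 + h2 + h3 + h4 + 2 * h5 + 2 * h8
    · change 2 * (2 * (2 * f.coeff (.a 1))) = 0
      linear_combination h1 + h2 - h3 - h4 - 2 * i * h5 + 2 * i * h8 +
        4 * (f.coeff (.a 1) - f.coeff (.a 3)) * hi
    · change 2 * (2 * (2 * f.coeff (.a 2))) = 0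
      linear_combination h1 + h2 + h3 + h4 - 2 * h5 - 2 * h8
    · change 2 * (2 * (2 * f.coeff (.a 3))) = 0
      linear_combination h1 + h2 - h3 - h4 + 2 * i * h5 - 2 * i * h8 +
        4 * (f.coeff (.a 3) - f.coeff (.a 1)) * hi
    · change 2 * (2 * (2 * f.coeff (.xa 0))) = 0
      linear_combination h1 - h2 + h3 - h4 - 2 * h6 + 2 * h7
    · change 2 * (2 * (2 * f.coeff (.xa 1))) = 0
      linear_combination h1 - h2 - h3 + h4 - 2 * i * h6 - 2 * i * h7 +
        4 * (f.coeff (.xa 1) - f.coeff (.xa 3)) * hi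
    · change 2 * (2 * (2 * f.coeff (.xa 2))) = 0
      linear_combination h1 - h2 + h3 - h4 + 2 * h6 - 2 * h7
    · change 2 * (2 * (2 * f.coeff (.xa 3))) = 0
      linear_combination h1 - h2 - h3 + h4 + 2 * i * h6 + 2 * i * h7 +
        4 * (f.coeff (.xa 3) - f.coeff (.xa 1)) * hi
  have : Module.Finite K (MonoidAlgebra K (QuaternionGroup 2)) :=
    .equiv (MonoidAlgebra.coeffLinearEquiv K).symm
  have hdim : Module.finrank K (MonoidAlgebra K (QuaternionGroup 2)) =
      Module.finrank K (K × K × K × K × Matrix (Fin 2) (Fin 2) K) := by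
    rw [(MonoidAlgebra.coeffLinearEquiv K).finrank_eq]
    simp [Module.finrank_matrix, QuaternionGroup.card]
  exact ⟨AlgEquiv.ofBijective φ
    ⟨hφ, (LinearMap.injective_iff_surjective_of_finrank_eq_finrank hdim).1 hφ⟩⟩

/-- Over `K = ℚ(ζ₄)`, the group algebra of the quaternion group `Q₈` is isomorphic, as a
`K`-algebra, to `K × K × K × K × M₂(K)`. -/
theorem stmt16 :
    Nonempty (MonoidAlgebra (CyclotomicField 4 ℚ) (QuaternionGroup 2) ≃ₐ[CyclotomicField 4 ℚ]
      (CyclotomicField 4 ℚ × CyclotomicField 4 ℚ × CyclotomicField 4 ℚ × CyclotomicField 4 ℚ ×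
        Matrix (Fin 2) (Fin 2) (CyclotomicField 4 ℚ))) := by
  obtain ⟨ζ, hζ⟩ := (CyclotomicField.isCyclotomicExtension 4 ℚ).exists_isPrimitiveRoot
    (Set.mem_singleton 4) four_ne_zero
  have h : IsPrimitiveRoot (ζ ^ 2) 2 := hζ.pow (by norm_num) (by norm_num)
  exact nonempty_monoidAlgebra_quaternionGroup_two_algEquiv ζ
    (by rw [← sq, h.eq_neg_one_of_two_right]) two_ne_zero
end

section
/- Every triple (x, y, z) of elements of the quaternion group Q₈ with x·y·z = 1 that generates Q₈ is Hurwitz equivalent to the triple (i, j, (i·j)⁻¹); that is, it can be transformed into (i, j, (i·j)⁻¹) by the equivalence relation generated by the Hurwitz moves (x, y, z) ↦ (x·y·x⁻¹, x, z) and (x, y, z) ↦ (x, y·z·y⁻¹, y) together with the pointwise action (x, y, z) ↦ (α(x), α(y), α(z)) of automorphisms α of Q₈. -/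
/-- One step of Hurwitz/braid moves on triples of elements of a group, together with the
pointwise action of group automorphisms. -/
def HurwitzMove {G : Type*} [Group G] (p p' : G × G × G) : Prop :=
  p' = (p.1 * p.2.1 * p.1⁻¹, p.1, p.2.2) ∨
  p' = (p.1, p.2.1 * p.2.2 * p.2.1⁻¹, p.2.1) ∨
  ∃ α : G ≃* G, p' = (α p.1, α p.2.1, α p.2.2)

/-- Hurwitz equivalence: the smallest equivalence relation on `G × G × G` containing the
Hurwitz moves and the pointwise action of `Aut(G)`. -/
def HurwitzEquiv {G : Type*} [Group G] : (G × G × G) → (G × G × G) → Prop :=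
  Relation.EqvGen HurwitzMove

namespace QuaternionGroup

/-- The map `QuaternionGroup 2 → G` determined by the images of the standard generators
`a 1` and `xa 0`. -/
def ofGenerators {G : Type*} [Group G] (x y : G) : QuaternionGroup 2 → G
  | a k => x ^ (k.val : ℕ)
  | xa k => y * x ^ (k.val : ℕ)

theorem ofGenerators_mul :
    ∀ x y : QuaternionGroup 2, x * y ≠ y * x → ∀ g h : QuaternionGroup 2,
      ofGenerators x y (g * h) = ofGenerators x y g * ofGenerators x y h := by
  decide +kernel

theorem ofGenerators_injective :
    ∀ x y : QuaternionGroup 2, x * y ≠ y * x → Function.Injective (ofGenerators x y) := by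
  unfold Function.Injective
  decide +kernel

/-- The automorphism group of `Q₈` acts transitively on noncommuting pairs. -/
theorem exists_mulEquiv_of_not_commute {x y : QuaternionGroup 2} (h : x * y ≠ y * x) :
    ∃ α : QuaternionGroup 2 ≃* QuaternionGroup 2, α (a 1) = x ∧ α (xa 0) = y := by
  let f : QuaternionGroup 2 →* QuaternionGroup 2 :=
    MonoidHom.mk' (ofGenerators x y) (ofGenerators_mul x y h)
  refine ⟨MulEquiv.ofBijective f
    (Finite.injective_iff_bijective.mp (ofGenerators_injective x y h)), ?_, ?_⟩
  · exact pow_one x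
  · exact mul_one y

end QuaternionGroup

theorem Subgroup.mul_comm_of_closure_eq_top {G : Type*} [Group G] {s : Set G}
    (hs : Subgroup.closure s = ⊤) (hcomm : ∀ a ∈ s, ∀ b ∈ s, a * b = b * a) (g h : G) :
    g * h = h * g := by
  have key := Subgroup.closure_le_centralizer_centralizer s
  have hle : Subgroup.closure s ≤ Subgroup.centralizer s :=
    (Subgroup.closure_le _).mpr fun a ha b hb => hcomm b hb a ha
  rw [hs] at key hle
  exact (key (Subgroup.mem_top h) g (hle (Subgroup.mem_top g)))

/-- Proposition 5.10: every spherical system of three generators of the quaternion group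
`Q₈` is Hurwitz equivalent to `(i, j, (i·j)⁻¹)`, where `i = a 1` and `j = xa 0`. -/
theorem stmt17 (x y z : QuaternionGroup 2)
    (hxyz : x * y * z = 1)
    (hgen : Subgroup.closure {x, y, z} = ⊤) :
    HurwitzEquiv (x, y, z)
      (QuaternionGroup.a 1, QuaternionGroup.xa 0,
        (QuaternionGroup.a 1 * QuaternionGroup.xa 0)⁻¹) := by
  have hz : z = (x * y)⁻¹ := eq_inv_of_mul_eq_one_right hxyz
  have hxy : x * y ≠ y * x := by
    intro h
    have hc : Commute x y := h
    have hxz : Commute x z := hz ▸ ((Commute.refl x).mul_right hc).inv_right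
    have hyz : Commute y z := hz ▸ (hc.symm.mul_right (Commute.refl y)).inv_right
    have hcomm := Subgroup.mul_comm_of_closure_eq_top hgen (by
      rintro a (rfl | rfl | rfl) b (rfl | rfl | rfl)
      exacts [rfl, hc, hxz, hc.symm, rfl, hyz, hxz.symm, hyz.symm, rfl])
      (QuaternionGroup.a 1) (QuaternionGroup.xa 0)
    revert hcomm
    decide
  obtain ⟨α, hx, hy⟩ := QuaternionGroup.exists_mulEquiv_of_not_commute hxy
  refine Relation.EqvGen.symm _ _ (Relation.EqvGen.rel _ _ (Or.inr (Or.inr ⟨α, ?_⟩)))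
  rw [map_inv, map_mul, hx, hy, hz]
end
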